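/- Fix an integer L ≥ 1, a start x₀ ∈ {0,…,L}, and a horizon n with n ≥ 2L². For ω ∈ {0,1}^n let X_ω be the reflected simple random walk on {0,…,L} driven by ω and started at x₀. Then the probability, over ω chosen uniformly from {0,1}^n, that there exists t ≤ n with X_ω(t) = 0 is at least 1/2. (This is the quantitative hitting statement underlying the claim that waiting time Θ(T² + r²) between measurements suffices for the random walk on the line of layers to reach a designated end region with constant probability.) -/

import Mathlib

open scoped Classical

/-- One step of the reflected simple random walk on `{0,…,L}`: from `0` move to
`1`, from `L` move to `L−1`, and otherwise move up if the coin is `true` and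
down if it is `false`. -/
def reflStep (L x : ℕ) (coin : Bool) : ℕ :=
  if x = 0 then 1 else if x = L then L - 1 else if coin then x + 1 else x - 1

/-- The reflected simple random walk on `{0,…,L}` started at `x₀` and driven by
the coin sequence `ω`. -/
def reflWalk (L x₀ : ℕ) (ω : ℕ → Bool) : ℕ → ℕ
  | 0 => x₀
  | t + 1 => reflStep L (reflWalk L x₀ ω t) (ω t)

/-- The probability that the reflected walk started at `x` avoids `0` up to time `m`, computed by
conditioning on the first step. -/
noncomputable def survivalProb (L : ℕ) : ℕ → ℕ → ℝ
  | 0, x => if x = 0 then 0 else 1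
  | m + 1, x => if x = 0 then 0 else
      (survivalProb L m (reflStep L x true) + survivalProb L m (reflStep L x false)) / 2

/-- A finite coin sequence, extended by `false`. -/
def extendCoins {n : ℕ} (ω : Fin n → Bool) (s : ℕ) : Bool :=
  if h : s < n then ω ⟨s, h⟩ else false

lemma extendCoins_cons_zero {n : ℕ} (b : Bool) (ω : Fin n → Bool) :
    extendCoins (Fin.cons b ω : Fin (n + 1) → Bool) 0 = b := by
  simp [extendCoins]

lemma extendCoins_cons_succ {n : ℕ} (b : Bool) (ω : Fin n → Bool) (s : ℕ) :
    extendCoins (Fin.cons b ω : Fin (n + 1) → Bool) (s + 1) = extendCoins ω s := by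
  by_cases h : s < n
  · have e : (⟨s + 1, Nat.succ_lt_succ h⟩ : Fin (n + 1)) = Fin.succ ⟨s, h⟩ := rfl
    simp only [extendCoins, h, Nat.succ_lt_succ h, dite_true, e, Fin.cons_succ]
  · simp [extendCoins, h]

lemma reflWalk_succ_eq (L x : ℕ) (ω : ℕ → Bool) (t : ℕ) :
    reflWalk L x ω (t + 1) = reflWalk L (reflStep L x (ω 0)) (fun s => ω (s + 1)) t := by
  induction t with
  | zero => rfl
  | succ t ih => rw [reflWalk, ih, reflWalk]

lemma reflWalk_cons_avoids_zero_iff (L x : ℕ) {n : ℕ} (b : Bool) (ω : Fin n → Bool) :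
    (∀ t ≤ n + 1, reflWalk L x (extendCoins (Fin.cons b ω : Fin (n + 1) → Bool)) t ≠ 0) ↔
      x ≠ 0 ∧ ∀ t ≤ n, reflWalk L (reflStep L x b) (extendCoins ω) t ≠ 0 := by
  have key : ∀ t, reflWalk L x (extendCoins (Fin.cons b ω : Fin (n + 1) → Bool)) (t + 1) =
      reflWalk L (reflStep L x b) (extendCoins ω) t := fun t => by
    rw [reflWalk_succ_eq, extendCoins_cons_zero]
    simp only [extendCoins_cons_succ]
  constructor
  · intro h
    exact ⟨h 0 (Nat.zero_le _), fun t ht => key t ▸ h (t + 1) (by omega)⟩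
  · rintro ⟨hx, h⟩ (_ | t) ht
    · exact hx
    · rw [key]
      exact h t (by omega)

lemma card_avoids_zero (L n x : ℕ) :
    ((Finset.univ.filter (fun ω : Fin n → Bool =>
      ∀ t ≤ n, reflWalk L x (extendCoins ω) t ≠ 0)).card : ℝ) = 2 ^ n * survivalProb L n x := by
  induction n generalizing x with
  | zero =>
    by_cases hx : x = 0 <;> simp [survivalProb, reflWalk, hx]
  | succ n ih =>
    simp only [Finset.card_filter, Nat.cast_sum, Nat.cast_ite, Nat.cast_one, Nat.cast_zero] at ih ⊢
    rw [← (Fin.consEquiv (fun _ : Fin (n + 1) => Bool)).sum_comp, Fintype.sum_prod_type,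
      Fintype.sum_bool]
    have hcons : ∀ (b : Bool) (ω : Fin n → Bool),
        Fin.consEquiv (fun _ : Fin (n + 1) => Bool) (b, ω) = Fin.cons b ω := fun _ _ => rfl
    simp only [hcons, reflWalk_cons_avoids_zero_iff]
    by_cases hx : x = 0
    · simp [survivalProb, hx]
    · simp only [ne_eq, hx, not_false_eq_true, true_and, survivalProb, if_false] at ih ⊢
      rw [ih, ih]
      ring

lemma survivalProb_succ_le (L m x : ℕ) : survivalProb L (m + 1) x ≤ survivalProb L m x := by
  induction m generalizing x with
  | zero =>
    have h : ∀ y, survivalProb L 0 y ≤ 1 := fun y => by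
      rw [survivalProb]; split_ifs <;> norm_num
    by_cases hx : x = 0
    · simp [survivalProb, hx]
    · have h₁ := h (reflStep L x true)
      have h₂ := h (reflStep L x false)
      rw [survivalProb.eq_2, if_neg hx, survivalProb.eq_1 L x, if_neg hx]
      linarith
  | succ m ih =>
    rw [survivalProb.eq_2 L x m, survivalProb.eq_2 L x (m + 1)]
    split_ifs
    · exact le_rfl
    · linarith [ih (reflStep L x true), ih (reflStep L x false)]

lemma reflStep_le {L x : ℕ} (hL : 1 ≤ L) (hx : x ≤ L) (b : Bool) : reflStep L x b ≤ L := by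
  unfold reflStep
  split_ifs <;> omega

/-- The function `x ↦ x (2L - x)` drops by `1` on average in each step away from `0`. -/
lemma average_reflStep {L x : ℕ} (hx : x ≤ L) (hx₀ : x ≠ 0) :
    (((reflStep L x true : ℕ) : ℝ) * (2 * L - (reflStep L x true : ℕ)) +
      ((reflStep L x false : ℕ) : ℝ) * (2 * L - (reflStep L x false : ℕ))) / 2 =
      (x : ℝ) * (2 * L - x) - 1 := by
  have h : 1 ≤ x := Nat.one_le_iff_ne_zero.mpr hx₀
  by_cases hxL : x = L
  · subst hxL
    simp only [reflStep, hx₀, if_true, if_false, Nat.cast_sub h, Nat.cast_one]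
    ring
  · simp only [reflStep, hx₀, hxL, if_true, if_false, Bool.false_eq_true, Nat.cast_sub h,
      Nat.cast_add, Nat.cast_one]
    ring

/-- The expected hitting time of `0`, truncated at `m`, is at most `x (2L - x)`. -/
lemma sum_survivalProb_le {L : ℕ} (hL : 1 ≤ L) (m : ℕ) {x : ℕ} (hx : x ≤ L) :
    ∑ k ∈ Finset.range m, survivalProb L k x ≤ (x : ℝ) * (2 * L - x) := by
  induction m generalizing x with
  | zero =>
    have : (x : ℝ) ≤ L := by exact_mod_cast hx
    simpa using mul_nonneg (Nat.cast_nonneg x) (by linarith [(Nat.cast_nonneg x : (0 : ℝ) ≤ x)])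
  | succ m ih =>
    rw [Finset.sum_range_succ']
    by_cases hx₀ : x = 0
    · simp [survivalProb, hx₀]
    · simp only [survivalProb, hx₀, if_false]
      rw [← Finset.sum_div, Finset.sum_add_distrib]
      linarith [ih (reflStep_le hL hx true), ih (reflStep_le hL hx false),
        average_reflStep hx hx₀]

lemma mul_survivalProb_le {L : ℕ} (hL : 1 ≤ L) (m : ℕ) {x : ℕ} (hx : x ≤ L) :
    m * survivalProb L m x ≤ (L : ℝ) ^ 2 := by
  have anti : Antitone (fun k => survivalProb L k x) :=
    antitone_nat_of_succ_le fun k => survivalProb_succ_le L k x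
  have h : m * survivalProb L m x ≤ ∑ k ∈ Finset.range m, survivalProb L k x := by
    simpa using Finset.card_nsmul_le_sum (Finset.range m) (fun k => survivalProb L k x)
      (survivalProb L m x) fun k hk => anti (Finset.mem_range.mp hk).le
  linarith [sum_survivalProb_le hL m hx, sq_nonneg ((L : ℝ) - x)]

/-- For `L ≥ 1`, a start `x₀ ∈ {0,…,L}`, and a horizon `n ≥ 2L²`, the
probability over a uniformly random coin sequence `ω ∈ {0,1}^n` that the
reflected simple random walk started at `x₀` hits `0` within `n` steps is at
least `1/2`. -/
theorem reflected_walk_hits_zero (L : ℕ) (hL : 1 ≤ L) (x₀ : ℕ) (hx : x₀ ≤ L)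
    (n : ℕ) (hn : 2 * L ^ 2 ≤ n) :
    (1 / 2 : ℝ) ≤
      (Finset.univ.filter (fun ω : Fin n → Bool =>
          ∃ t ≤ n,
            reflWalk L x₀ (fun s => if h : s < n then ω ⟨s, h⟩ else false) t
              = 0)).card / 2 ^ n := by
  have hpos : (0 : ℝ) < 2 ^ n := by positivity
  have hsurv : survivalProb L n x₀ ≤ 1 / 2 := by
    have hL' : (0 : ℝ) < (L : ℝ) ^ 2 := by positivity
    have hn' : 2 * (L : ℝ) ^ 2 ≤ n := by exact_mod_cast hn
    have h := mul_survivalProb_le hL n hx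
    by_contra! hlt
    nlinarith
  have hcard := Finset.card_filter_add_card_filter_not (s := Finset.univ)
    (fun ω : Fin n → Bool => ∃ t ≤ n, reflWalk L x₀ (extendCoins ω) t = 0)
  simp only [not_exists, not_and, Finset.card_univ, Fintype.card_fun, Fintype.card_fin,
    Fintype.card_bool] at hcard
  have havoid := card_avoids_zero L n x₀
  have hsum := congrArg (Nat.cast : ℕ → ℝ) hcard
  simp only [ne_eq] at havoid
  push_cast at hsum
  rw [havoid] at hsum
  rw [le_div_iff₀ hpos]
  change _ ≤ ((Finset.univ.filter (fun ω : Fin n → Bool =>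
    ∃ t ≤ n, reflWalk L x₀ (extendCoins ω) t = 0)).card : ℝ)
  nlinarith
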